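/- arXiv:2512.24915 — 3 statements merged into one kernel-verified Lean document; each statement's English description precedes it below -/
import Mathlib

section
/- Let L > 0 and M > 0 be real numbers. For every x ∈ [0,L] one has ∫₀ᴸ G(x,s) ds = (L·x − x²)/(2M) + (sinh(√M·x) + sinh(√M·(L−x)) − sinh(√M·L))/(M²·sinh(√M·L)). -/
open Real

/-- The Green function `G` of the operator `y'''' - M y''` with Navier
boundary conditions on `[0, L]`, given by the explicit piecewise formula. -/
noncomputable def GreenK (M L x s : ℝ) : ℝ :=
  if x ≤ s then
    x * (L - s) / (M * L) -
      Real.sinh (Real.sqrt M * x) * Real.sinh (Real.sqrt M * (L - s)) /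
        (M * Real.sqrt M * Real.sinh (Real.sqrt M * L))
  else
    s * (L - x) / (M * L) -
      Real.sinh (Real.sqrt M * s) * Real.sinh (Real.sqrt M * (L - x)) /
        (M * Real.sqrt M * Real.sinh (Real.sqrt M * L))

lemma hasDerivAt_linear_sub_cosh (a b k t : ℝ) (hk : k ≠ 0) :
    HasDerivAt (fun s => a * s ^ 2 / 2 - b * Real.cosh (k * s) / k)
      (a * t - b * Real.sinh (k * t)) t := by
  have h1 : HasDerivAt (fun s : ℝ => a * s ^ 2 / 2) (a * t) t := by
    refine (((hasDerivAt_pow 2 t).const_mul a).div_const 2).congr_deriv ?_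
    norm_num
    ring
  have h2 : HasDerivAt (fun s : ℝ => b * Real.cosh (k * s) / k) (b * Real.sinh (k * t)) t := by
    refine (((((hasDerivAt_id t).const_mul k).cosh).const_mul b).div_const k).congr_deriv ?_
    simp only [id_eq]
    field_simp
  exact h1.sub h2

lemma integral_linear_sub_sinh (a b k y : ℝ) (hk : k ≠ 0) :
    (∫ s in (0 : ℝ)..y, (a * s - b * Real.sinh (k * s))) =
      a * y ^ 2 / 2 - b * (Real.cosh (k * y) - 1) / k := by
  rw [intervalIntegral.integral_eq_sub_of_hasDerivAt
    (fun t _ => hasDerivAt_linear_sub_cosh a b k t hk)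
    (Continuous.intervalIntegrable (by fun_prop) _ _)]
  simp
  ring

lemma GreenK_of_le {M L x s : ℝ} (h : s ≤ x) :
    GreenK M L x s = (L - x) / (M * L) * s -
      Real.sinh (Real.sqrt M * (L - x)) / (M * Real.sqrt M * Real.sinh (Real.sqrt M * L)) *
        Real.sinh (Real.sqrt M * s) := by
  rcases h.lt_or_eq with h | rfl
  · rw [GreenK, if_neg h.not_ge]
    ring
  · rw [GreenK, if_pos le_rfl]
    ring

lemma GreenK_of_ge {M L x s : ℝ} (h : x ≤ s) :
    GreenK M L x s = x / (M * L) * (L - s) -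
      Real.sinh (Real.sqrt M * x) / (M * Real.sqrt M * Real.sinh (Real.sqrt M * L)) *
        Real.sinh (Real.sqrt M * (L - s)) := by
  rw [GreenK, if_pos h]
  ring

theorem stmt5 (L M : ℝ) (hL : 0 < L) (hM : 0 < M) :
    ∀ x ∈ Set.Icc (0:ℝ) L,
      (∫ s in (0:ℝ)..L, GreenK M L x s)
        = (L * x - x ^ 2) / (2 * M)
          + (Real.sinh (Real.sqrt M * x) + Real.sinh (Real.sqrt M * (L - x))
              - Real.sinh (Real.sqrt M * L)) / (M ^ 2 * Real.sinh (Real.sqrt M * L)) := by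
  rintro x ⟨hx0, hxL⟩
  have hk : 0 < Real.sqrt M := Real.sqrt_pos.2 hM
  have hS : 0 < Real.sinh (Real.sqrt M * L) := Real.sinh_pos_iff.2 (mul_pos hk hL)
  have left_eq : Set.EqOn (fun s => (L - x) / (M * L) * s -
      Real.sinh (Real.sqrt M * (L - x)) / (M * Real.sqrt M * Real.sinh (Real.sqrt M * L)) *
        Real.sinh (Real.sqrt M * s)) (GreenK M L x) (Set.uIcc 0 x) := by
    intro s hs
    rw [Set.uIcc_of_le hx0] at hs
    exact (GreenK_of_le hs.2).symm
  have right_eq : Set.EqOn (fun s => x / (M * L) * (L - s) -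
      Real.sinh (Real.sqrt M * x) / (M * Real.sqrt M * Real.sinh (Real.sqrt M * L)) *
        Real.sinh (Real.sqrt M * (L - s))) (GreenK M L x) (Set.uIcc x L) := by
    intro s hs
    rw [Set.uIcc_of_le hxL] at hs
    exact (GreenK_of_ge hs.1).symm
  have left_int : IntervalIntegrable (GreenK M L x) MeasureTheory.volume 0 x :=
    (Continuous.intervalIntegrable (by fun_prop) _ _).congr
      (left_eq.mono Set.uIoc_subset_uIcc)
  have right_int : IntervalIntegrable (GreenK M L x) MeasureTheory.volume x L :=
    (Continuous.intervalIntegrable (by fun_prop) _ _).congr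
      (right_eq.mono Set.uIoc_subset_uIcc)
  rw [← intervalIntegral.integral_add_adjacent_intervals left_int right_int,
    ← intervalIntegral.integral_congr left_eq, ← intervalIntegral.integral_congr right_eq,
    intervalIntegral.integral_comp_sub_left (fun s => x / (M * L) * s -
      Real.sinh (Real.sqrt M * x) / (M * Real.sqrt M * Real.sinh (Real.sqrt M * L)) *
        Real.sinh (Real.sqrt M * s)) L, sub_self,
    integral_linear_sub_sinh _ _ _ _ hk.ne', integral_linear_sub_sinh _ _ _ _ hk.ne']
  have add_formula : Real.sinh (Real.sqrt M * L) =
      Real.sinh (Real.sqrt M * x) * Real.cosh (Real.sqrt M * (L - x)) +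
        Real.cosh (Real.sqrt M * x) * Real.sinh (Real.sqrt M * (L - x)) := by
    rw [← Real.sinh_add]
    ring_nf
  have hsq : M = Real.sqrt M ^ 2 := (Real.sq_sqrt hM.le).symm
  generalize Real.sqrt M = k at *
  generalize Real.sinh (k * L) = S at *
  generalize Real.sinh (k * x) = a at *
  generalize Real.sinh (k * (L - x)) = b at *
  generalize Real.cosh (k * x) = c at *
  generalize Real.cosh (k * (L - x)) = d at *
  have poly_part : (L - x) / (M * L) * x ^ 2 / 2 + x / (M * L) * (L - x) ^ 2 / 2 =
      (L * x - x ^ 2) / (2 * M) := by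
    field_simp
    ring
  have sinh_part : b / (M * k * S) * (c - 1) / k + a / (M * k * S) * (d - 1) / k =
      -((a + b - S) / (M ^ 2 * S)) := by
    rw [hsq]
    field_simp
    rw [add_formula]
    ring
  linear_combination poly_part - sinh_part
end

section
/- Let L > 0 and M > 0 be real numbers. Then the maximum over x ∈ [0,L] of ∫₀ᴸ G(x,s) ds is attained at x = L/2 and equals L²/(8M) + 2·sinh(√M·L/2)/(M²·sinh(√M·L)) − 1/M²; moreover this maximum value is strictly less than L²/(8M). -/
open Real

theorem continuous_greenK (M L x : ℝ) : Continuous (GreenK M L x) := by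
  unfold GreenK
  refine Continuous.if_le (by fun_prop) (by fun_prop) continuous_const continuous_id ?_
  rintro s rfl
  ring

theorem integral_greenK_left {L M x : ℝ} (hM : 0 < M) (hx : 0 ≤ x) :
    (∫ s in (0:ℝ)..x, GreenK M L x s) = x ^ 2 * (L - x) / (2 * (M * L)) -
      (cosh (√M * x) - 1) * sinh (√M * (L - x)) / (M ^ 2 * sinh (√M * L)) := by
  have hk : √M ≠ 0 := (sqrt_pos.2 hM).ne'
  have hd : ∀ s ∈ Set.uIcc 0 x, HasDerivAt (fun s ↦ s ^ 2 / 2 * ((L - x) / (M * L)) -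
      cosh (√M * s) / √M * (sinh (√M * (L - x)) / (M * √M * sinh (√M * L))))
      (GreenK M L x s) s := by
    intro s hs
    rw [Set.uIcc_of_le hx] at hs
    have h := (((hasDerivAt_id s).pow 2).div_const 2).mul_const ((L - x) / (M * L))
    have h' := ((((hasDerivAt_id s).const_mul √M).cosh).div_const √M).mul_const
      (sinh (√M * (L - x)) / (M * √M * sinh (√M * L)))
    have hG : GreenK M L x s = s * (L - x) / (M * L) -
        sinh (√M * s) * sinh (√M * (L - x)) / (M * √M * sinh (√M * L)) := by
      unfold GreenK
      split_ifs with hxs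
      · rw [le_antisymm hxs hs.2]
      · rfl
    rw [hG]
    refine (h.sub h').congr_deriv ?_
    simp only [id]
    field_simp
    ring
  rw [intervalIntegral.integral_eq_sub_of_hasDerivAt hd
    ((continuous_greenK M L x).intervalIntegrable _ _)]
  have hden : M ^ 2 * sinh (√M * L) = √M * (M * √M * sinh (√M * L)) := by
    linear_combination (-M * sinh (√M * L)) * sq_sqrt hM.le
  rw [hden]
  simp only [mul_zero, cosh_zero]
  field_simp
  ring

theorem greenK_reflect {L M : ℝ} (x s : ℝ) : GreenK M L (L - x) (L - s) = GreenK M L x s := by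
  unfold GreenK
  rcases lt_trichotomy x s with h | rfl | h
  · rw [if_neg (by linarith), if_pos h.le]
    simp only [sub_sub_cancel]
    ring
  · simp only [le_refl, if_true, sub_sub_cancel]
    ring
  · rw [if_pos (by linarith), if_neg (by linarith)]
    simp only [sub_sub_cancel]
    ring

theorem integral_greenK {L M x : ℝ} (hL : 0 < L) (hM : 0 < M) (hx : x ∈ Set.Icc 0 L) :
    (∫ s in (0:ℝ)..L, GreenK M L x s) = x * (L - x) / (2 * M) - 1 / M ^ 2 +
      cosh (√M * (x - L / 2)) / (M ^ 2 * cosh (√M * L / 2)) := by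
  have hint := fun a b ↦ (continuous_greenK M L x).intervalIntegrable
    (μ := MeasureTheory.volume) a b
  have hright : (∫ s in x..L, GreenK M L x s) = ∫ s in (0:ℝ)..(L - x), GreenK M L (L - x) s := by
    have h := intervalIntegral.integral_comp_sub_left (a := x) (b := L) (GreenK M L (L - x)) L
    simp only [greenK_reflect, sub_self] at h
    exact h
  rw [← intervalIntegral.integral_add_adjacent_intervals (hint 0 x) (hint x L), hright,
    integral_greenK_left hM hx.1, integral_greenK_left hM (sub_nonneg.2 hx.2), sub_sub_cancel]
  set p := √M * L / 2 with hp
  set q := √M * (x - L / 2) with hq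
  have hx' : √M * x = p + q := by rw [hp, hq]; ring
  have hy' : √M * (L - x) = p - q := by rw [hp, hq]; ring
  have hL' : √M * L = 2 * p := by rw [hp]; ring
  have hp0 : 0 < p := by positivity
  have hs : sinh p ≠ 0 := (sinh_pos_iff.2 hp0).ne'
  have hc : cosh p ≠ 0 := (cosh_pos p).ne'
  rw [hx', hy', hL', sinh_two_mul, sinh_add, cosh_add, sinh_sub, cosh_sub]
  field_simp
  linear_combination (-2 * L * sinh p * cosh p) * cosh_sq q

theorem Real.sinh_le_mul_cosh {v : ℝ} (hv : 0 ≤ v) : sinh v ≤ v * cosh v := by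
  have hmono : MonotoneOn (fun v ↦ v * cosh v - sinh v) (Set.Ici 0) := by
    refine monotoneOn_of_hasDerivWithinAt_nonneg (f' := fun v ↦ v * sinh v) (convex_Ici 0)
      (by fun_prop) (fun v _ ↦ ?_) (fun v hv ↦ ?_)
    · have h := ((hasDerivAt_id v).mul (hasDerivAt_cosh v)).sub (hasDerivAt_sinh v)
      exact (h.congr_deriv (by simp)).hasDerivWithinAt
    · rw [interior_Ici, Set.mem_Ioi] at hv
      exact mul_nonneg hv.le (sinh_nonneg_iff.2 hv.le)
  have h := hmono Set.self_mem_Ici hv hv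
  simpa using h

theorem Real.cosh_sub_one_le {u a : ℝ} (h : |u| ≤ |a|) : cosh u - 1 ≤ u ^ 2 / 2 * cosh a := by
  have hua : cosh u ≤ cosh a := cosh_le_cosh.2 h
  have hu : cosh u = 1 + 2 * sinh (|u| / 2) ^ 2 := by
    rw [← cosh_abs u, show |u| = 2 * (|u| / 2) by ring, cosh_two_mul, cosh_sq]
    ring_nf
  have hs := pow_le_pow_left₀ (sinh_nonneg_iff.2 (by positivity))
    (sinh_le_mul_cosh (v := |u| / 2) (by positivity)) 2
  have hc : cosh (|u| / 2) ^ 2 ≤ cosh a := by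
    rw [cosh_sq]
    nlinarith [one_le_cosh u]
  rw [mul_pow, div_pow, sq_abs] at hs
  nlinarith [mul_le_mul_of_nonneg_left hc (sq_nonneg u)]

theorem stmt6 (L M : ℝ) (hL : 0 < L) (hM : 0 < M) :
    (∀ x ∈ Set.Icc (0:ℝ) L,
      (∫ s in (0:ℝ)..L, GreenK M L x s) ≤ ∫ s in (0:ℝ)..L, GreenK M L (L / 2) s) ∧
    (∫ s in (0:ℝ)..L, GreenK M L (L / 2) s)
      = L ^ 2 / (8 * M)
        + 2 * Real.sinh (Real.sqrt M * L / 2) / (M ^ 2 * Real.sinh (Real.sqrt M * L))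
        - 1 / M ^ 2 ∧
    (∫ s in (0:ℝ)..L, GreenK M L (L / 2) s) < L ^ 2 / (8 * M) := by
  have hmid := integral_greenK hL hM (x := L / 2) ⟨by positivity, by linarith⟩
  rw [sub_self, mul_zero, cosh_zero] at hmid
  have hp : 0 < √M * L / 2 := by positivity
  have hc : 0 < cosh (√M * L / 2) := cosh_pos _
  refine ⟨fun x hx ↦ ?_, ?_, ?_⟩
  · rw [hmid, integral_greenK hL hM hx]
    have hu : |√M * (x - L / 2)| ≤ |√M * L / 2| := by
      rw [mul_div_assoc, abs_mul, abs_mul]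
      refine mul_le_mul_of_nonneg_left ?_ (abs_nonneg _)
      rw [abs_of_pos (half_pos hL), abs_le]
      constructor <;> linarith [hx.1, hx.2]
    have h := cosh_sub_one_le hu
    rw [mul_pow, sq_sqrt hM.le] at h
    have hdiff : (cosh (√M * (x - L / 2)) - 1) / (M ^ 2 * cosh (√M * L / 2)) ≤
        (x - L / 2) ^ 2 / (2 * M) := by
      rw [div_le_div_iff₀ (by positivity) (by positivity)]
      nlinarith [mul_le_mul_of_nonneg_left h hM.le]
    rw [sub_div] at hdiff
    have hsq : L / 2 * (L - L / 2) / (2 * M) - x * (L - x) / (2 * M) =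
        (x - L / 2) ^ 2 / (2 * M) := by ring
    linarith
  · have hs : sinh (√M * L / 2) ≠ 0 := (sinh_pos_iff.2 hp).ne'
    rw [hmid, show √M * L = 2 * (√M * L / 2) by ring, sinh_two_mul,
      show 2 * (√M * L / 2) / 2 = √M * L / 2 by ring]
    field_simp
    ring
  · rw [hmid]
    have h1 : 1 / (M ^ 2 * cosh (√M * L / 2)) < 1 / M ^ 2 := by
      refine one_div_lt_one_div_of_lt (by positivity) ?_
      exact lt_mul_of_one_lt_right (by positivity) (one_lt_cosh.2 hp.ne')
    have h2 : L / 2 * (L - L / 2) / (2 * M) = L ^ 2 / (8 * M) := by ring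
    linarith
end

section
/- Let L > 0 and M > 0 be real numbers, and let N be a real number with 0 ≤ N ≤ (4M/L³)·σ(√M·L). Then for every continuous function p : [0,L] → ℝ with p ≥ 0 on [0,L], the function y given by y(x) = ∫₀ᴸ G(x,s)p(s)ds − (N·∫₀ᴸ G(x,s)ds)/(1 + N·∫₀ᴸ∫₀ᴸ G(x,s)ds dx) · ∫₀ᴸ∫₀ᴸ G(x,s)p(s)ds dx satisfies y(x) ≥ 0 and y''(x) ≤ 0 for all x ∈ [0,L]; conversely, if p ≤ 0 on [0,L], then y(x) ≤ 0 and y''(x) ≥ 0 for all x ∈ [0,L]. -/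
open Real

/-- The auxiliary function `σ(x) = 3x³ / (6x cosh x + 6x − 12 sinh x − x³)`. -/
noncomputable def sigmaFun (x : ℝ) : ℝ :=
  3 * x ^ 3 / (6 * x * Real.cosh x + 6 * x - 12 * Real.sinh x - x ^ 3)

theorem HasDerivAt.comp_max_zero {f f' : ℝ → ℝ} (hf : ∀ t, HasDerivAt f (f' t) t)
    (h0 : f' 0 = 0) (t : ℝ) :
    HasDerivAt (fun t => f (max t 0)) (f' (max t 0)) t := by
  have hneg : ∀ u ∈ Set.Iic (0 : ℝ), f (max u 0) = f 0 := fun u hu => by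
    rw [max_eq_right (Set.mem_Iic.1 hu)]
  have hpos : ∀ u ∈ Set.Ici (0 : ℝ), f (max u 0) = f u := fun u hu => by
    rw [max_eq_left (Set.mem_Ici.1 hu)]
  rcases lt_trichotomy t 0 with h | rfl | h
  · rw [max_eq_right h.le, h0]
    exact (hasDerivAt_const t (f 0)).congr_of_eventuallyEq
      (Filter.eventually_of_mem (Iic_mem_nhds h) hneg)
  · rw [max_self, h0, ← hasDerivWithinAt_univ, ← Set.Iic_union_Ici (a := (0 : ℝ))]
    refine HasDerivWithinAt.union ?_ ?_
    · exact (hasDerivWithinAt_const _ _ (f 0)).congr hneg (hneg 0 Set.self_mem_Iic)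
    · exact (h0 ▸ hf 0).hasDerivWithinAt.congr hpos (hpos 0 Set.self_mem_Ici)
  · rw [max_eq_left h.le]
    exact (hf t).congr_of_eventuallyEq (Filter.eventually_of_mem (Ici_mem_nhds h) hpos)

theorem hasDerivAt_intervalIntegral_of_continuous {F F' : ℝ → ℝ → ℝ} {a b : ℝ}
    (hF : Continuous fun q : ℝ × ℝ => F q.1 q.2) (hF' : Continuous fun q : ℝ × ℝ => F' q.1 q.2)
    (h : ∀ x s, HasDerivAt (fun x => F x s) (F' x s) x) (x : ℝ) :
    HasDerivAt (fun x => ∫ s in a..b, F x s) (∫ s in a..b, F' x s) x := by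
  have hc : ∀ x, Continuous (F x) := fun x => hF.comp (Continuous.prodMk_right x)
  have hc' : ∀ x, Continuous (F' x) := fun x => hF'.comp (Continuous.prodMk_right x)
  obtain ⟨C, hC⟩ := ((isCompact_Icc (a := x - 1) (b := x + 1)).prod
    (isCompact_uIcc (a := a) (b := b))).exists_bound_of_continuousOn hF'.continuousOn
  refine (intervalIntegral.hasDerivAt_integral_of_dominated_loc_of_deriv_le
    (bound := fun _ => C) (Icc_mem_nhds (by linarith) (by linarith : x < x + 1))
    (Filter.Eventually.of_forall fun x => (hc x).aestronglyMeasurable)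
    ((hc x).intervalIntegrable _ _) (hc' x).aestronglyMeasurable
    (Filter.Eventually.of_forall fun s hs u hu => hC (u, s) ⟨hu, Set.uIoc_subset_uIcc hs⟩)
    intervalIntegrable_const
    (Filter.Eventually.of_forall fun s _ u _ => h u s)).2

namespace Real

theorem sinh_le_self_mul_cosh {a : ℝ} (ha : 0 ≤ a) : sinh a ≤ a * cosh a := by
  have hd : ∀ t, HasDerivAt (fun t => t * cosh t - sinh t) (t * sinh t) t := fun t =>
    (((hasDerivAt_id t).mul (hasDerivAt_cosh t)).sub (hasDerivAt_sinh t)).congr_deriv (by simp)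
  have hm : Monotone fun t : ℝ => t * cosh t - sinh t :=
    monotone_of_hasDerivAt_nonneg hd fun t => by
      rcases le_total 0 t with h | h
      · exact mul_nonneg h (sinh_nonneg_iff.2 h)
      · exact mul_nonneg_of_nonpos_of_nonpos h (sinh_nonpos_iff.2 h)
  simpa using hm ha

theorem tanh_le_tanh {a b : ℝ} (h : a ≤ b) : tanh a ≤ tanh b := by
  rw [tanh_eq_sinh_div_cosh, tanh_eq_sinh_div_cosh, div_le_div_iff₀ (cosh_pos a) (cosh_pos b)]
  have := sinh_nonneg_iff.2 (sub_nonneg.2 h)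
  rw [sinh_sub] at this
  linarith

theorem tanh_le_self {a : ℝ} (ha : 0 ≤ a) : tanh a ≤ a := by
  rw [tanh_eq_sinh_div_cosh, div_le_iff₀ (cosh_pos a)]
  exact sinh_le_self_mul_cosh ha

theorem tanh_half_mul_sinh (z : ℝ) : tanh (z / 2) * sinh z = cosh z - 1 := by
  obtain ⟨a, rfl⟩ : ∃ a, z = 2 * a := ⟨z / 2, by ring⟩
  rw [mul_div_cancel_left₀ a two_ne_zero, sinh_two_mul, cosh_two_mul, cosh_sq,
    tanh_eq_sinh_div_cosh]
  field_simp [(cosh_pos a).ne']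
  ring

theorem tanh_half_mul_cosh_add_one (z : ℝ) : tanh (z / 2) * (cosh z + 1) = sinh z := by
  obtain ⟨a, rfl⟩ : ∃ a, z = 2 * a := ⟨z / 2, by ring⟩
  have := (cosh_pos a).ne'
  rw [mul_div_cancel_left₀ a two_ne_zero, sinh_two_mul, cosh_two_mul, sinh_sq,
    tanh_eq_sinh_div_cosh]
  field_simp
  ring

end Real

/-- The Green function of `-u'' + m² u` with Dirichlet boundary conditions on `[0, L]`. -/
noncomputable def dirichletK (m L x s : ℝ) : ℝ :=
  sinh (m * x) * sinh (m * (L - s)) / (m * sinh (m * L)) - sinh (m * max (x - s) 0) / m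

/-- The integral of `dirichletK m L x` over `[0, L]`. -/
noncomputable def dirichletMass (m L x : ℝ) : ℝ :=
  (tanh (m * L / 2) * sinh (m * x) - cosh (m * x) + 1) / m ^ 2

/-- The integral of `GreenK (m ^ 2) L x` over `[0, L]`. -/
noncomputable def greenMass (m L x : ℝ) : ℝ :=
  (x * (L - x) / 2 - dirichletMass m L x) / m ^ 2

section

variable {m L : ℝ}

theorem sinh_mul_sinh_sub_swap (m L x s : ℝ) :
    sinh (m * x) * sinh (m * (L - s)) - sinh (m * s) * sinh (m * (L - x)) =
      sinh (m * L) * sinh (m * (x - s)) := by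
  simp only [mul_sub, sinh_sub]
  ring

theorem dirichletK_of_le {x s : ℝ} (h : x ≤ s) :
    dirichletK m L x s = sinh (m * x) * sinh (m * (L - s)) / (m * sinh (m * L)) := by
  simp [dirichletK, max_eq_right (sub_nonpos.2 h)]

theorem dirichletK_of_ge (hm : 0 < m) (hL : 0 < L) {x s : ℝ} (h : s ≤ x) :
    dirichletK m L x s = sinh (m * (L - x)) * sinh (m * s) / (m * sinh (m * L)) := by
  have hS : 0 < sinh (m * L) := sinh_pos_iff.2 (by positivity)
  rw [dirichletK, max_eq_left (sub_nonneg.2 h), eq_comm, div_eq_iff (by positivity)]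
  have := sinh_mul_sinh_sub_swap m L x s
  field_simp
  linarith

theorem GreenK_sq_eq (hm : 0 < m) (hL : 0 < L) (x s : ℝ) :
    GreenK (m ^ 2) L x s = x * (L - s) / (m ^ 2 * L) -
      sinh (m * x) * sinh (m * (L - s)) / (m ^ 3 * sinh (m * L)) +
      (sinh (m * max (x - s) 0) / m - max (x - s) 0) / m ^ 2 := by
  have hS : 0 < sinh (m * L) := sinh_pos_iff.2 (by positivity)
  rw [GreenK, sqrt_sq hm.le]
  split_ifs with h
  · rw [max_eq_right (sub_nonpos.2 h)]
    simp
    ring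
  · rw [max_eq_left (sub_nonneg.2 (not_le.1 h).le)]
    have := sinh_mul_sinh_sub_swap m L x s
    generalize sinh (m * L) = S, sinh (m * x) = a, sinh (m * s) = b, sinh (m * (L - s)) = c,
      sinh (m * (L - x)) = d, sinh (m * (x - s)) = e at *
    field_simp
    linear_combination L * this

theorem GreenK_comm (M L x s : ℝ) : GreenK M L x s = GreenK M L s x := by
  unfold GreenK
  split_ifs with h₁ h₂ h₂
  · rw [le_antisymm h₁ h₂]
  · rfl
  · rfl
  · exact absurd (le_of_not_ge h₁) h₂

theorem continuous_GreenK_sq (hm : 0 < m) (hL : 0 < L) :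
    Continuous fun q : ℝ × ℝ => GreenK (m ^ 2) L q.1 q.2 := by
  simp only [GreenK_sq_eq hm hL]
  fun_prop

theorem continuous_dirichletK (m L : ℝ) :
    Continuous fun q : ℝ × ℝ => dirichletK m L q.1 q.2 := by
  unfold dirichletK
  fun_prop

/-- The first derivative of `GreenK (m ^ 2) L` in its first variable. -/
noncomputable def greenKDeriv (m L x s : ℝ) : ℝ :=
  (L - s) / (m ^ 2 * L) - cosh (m * x) * sinh (m * (L - s)) / (m ^ 2 * sinh (m * L)) +
    (cosh (m * max (x - s) 0) - 1) / m ^ 2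

theorem continuous_greenKDeriv (m L : ℝ) :
    Continuous fun q : ℝ × ℝ => greenKDeriv m L q.1 q.2 := by
  unfold greenKDeriv
  fun_prop

theorem hasDerivAt_sinh_mul (m t : ℝ) :
    HasDerivAt (fun t => sinh (m * t)) (m * cosh (m * t)) t :=
  ((hasDerivAt_sinh _).comp t ((hasDerivAt_id t).const_mul m)).congr_deriv (by simp only [id]; ring)

theorem hasDerivAt_cosh_mul (m t : ℝ) :
    HasDerivAt (fun t => cosh (m * t)) (m * sinh (m * t)) t :=
  ((hasDerivAt_cosh _).comp t ((hasDerivAt_id t).const_mul m)).congr_deriv (by simp only [id]; ring)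

theorem hasDerivAt_GreenK_sq (hm : 0 < m) (hL : 0 < L) (x s : ℝ) :
    HasDerivAt (fun x => GreenK (m ^ 2) L x s) (greenKDeriv m L x s) x := by
  have hS : 0 < sinh (m * L) := sinh_pos_iff.2 (by positivity)
  have hr := (HasDerivAt.comp_max_zero (f := fun t => (sinh (m * t) / m - t) / m ^ 2)
    (f' := fun t => (cosh (m * t) - 1) / m ^ 2)
    (fun t => ((((hasDerivAt_sinh_mul m t).div_const m).sub (hasDerivAt_id t)).div_const
      (m ^ 2)).congr_deriv (by field_simp)) (by simp) (x - s)).comp x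
    ((hasDerivAt_id x).sub_const s)
  simp only [GreenK_sq_eq hm hL]
  refine (((((hasDerivAt_id x).mul_const (L - s)).div_const (m ^ 2 * L)).sub
    (((hasDerivAt_sinh_mul m x).mul_const (sinh (m * (L - s)))).div_const
      (m ^ 3 * sinh (m * L)))).add hr).congr_deriv ?_
  rw [greenKDeriv]
  field_simp

theorem hasDerivAt_greenKDeriv (hm : 0 < m) (hL : 0 < L) (x s : ℝ) :
    HasDerivAt (fun x => greenKDeriv m L x s) (-dirichletK m L x s) x := by
  have hS : 0 < sinh (m * L) := sinh_pos_iff.2 (by positivity)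
  have hr := (HasDerivAt.comp_max_zero (f := fun t => (cosh (m * t) - 1) / m ^ 2)
    (f' := fun t => sinh (m * t) / m)
    (fun t => (((hasDerivAt_cosh_mul m t).sub_const 1).div_const
      (m ^ 2)).congr_deriv (by field_simp)) (by simp) (x - s)).comp x
    ((hasDerivAt_id x).sub_const s)
  unfold greenKDeriv
  refine (((((hasDerivAt_cosh_mul m x).mul_const (sinh (m * (L - s)))).div_const
      (m ^ 2 * sinh (m * L))).const_sub ((L - s) / (m ^ 2 * L))).add hr).congr_deriv ?_
  rw [dirichletK]
  field_simp
  ring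

theorem integral_dirichletK (hm : 0 < m) (hL : 0 < L) {x : ℝ} (hx : x ∈ Set.Icc 0 L) :
    ∫ s in (0 : ℝ)..L, dirichletK m L x s = dirichletMass m L x := by
  have hS : 0 < sinh (m * L) := sinh_pos_iff.2 (by positivity)
  have hd : ∀ s, HasDerivAt (fun s => (cosh (m * max (x - s) 0) - 1) / m ^ 2 -
      sinh (m * x) * cosh (m * (L - s)) / (m ^ 2 * sinh (m * L))) (dirichletK m L x s) s := by
    intro s
    have hr := (HasDerivAt.comp_max_zero (f := fun t => (cosh (m * t) - 1) / m ^ 2)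
      (f' := fun t => sinh (m * t) / m)
      (fun t => (((hasDerivAt_cosh_mul m t).sub_const 1).div_const
        (m ^ 2)).congr_deriv (by field_simp)) (by simp) (x - s)).comp s
      ((hasDerivAt_id s).const_sub x)
    refine (hr.sub ((((hasDerivAt_cosh_mul m (L - s)).comp s
      ((hasDerivAt_id s).const_sub L)).const_mul (sinh (m * x))).div_const
        (m ^ 2 * sinh (m * L)))).congr_deriv ?_
    rw [dirichletK]
    field_simp
    ring
  rw [intervalIntegral.integral_eq_sub_of_hasDerivAt (fun s _ => hd s)
    (((continuous_dirichletK m L).comp (Continuous.prodMk_right x)).intervalIntegrable _ _)]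
  have hT := tanh_half_mul_sinh (m * L)
  rw [max_eq_right (sub_nonpos.2 hx.2), sub_zero, max_eq_left hx.1, dirichletMass]
  simp only [mul_zero, cosh_zero, sub_self, sub_zero]
  field_simp
  linear_combination (-sinh (m * x)) * hT

theorem integral_GreenK_sq (hm : 0 < m) (hL : 0 < L) {x : ℝ} (hx : x ∈ Set.Icc 0 L) :
    ∫ s in (0 : ℝ)..L, GreenK (m ^ 2) L x s = greenMass m L x := by
  have hS : 0 < sinh (m * L) := sinh_pos_iff.2 (by positivity)
  have hd : ∀ s, HasDerivAt (fun s => -(x * (L - s) ^ 2 / (2 * m ^ 2 * L)) +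
      sinh (m * x) * cosh (m * (L - s)) / (m ^ 4 * sinh (m * L)) -
      ((cosh (m * max (x - s) 0) - 1) / m ^ 2 - max (x - s) 0 ^ 2 / 2) / m ^ 2)
      (GreenK (m ^ 2) L x s) s := by
    intro s
    have hr := (HasDerivAt.comp_max_zero
      (f := fun t => ((cosh (m * t) - 1) / m ^ 2 - t ^ 2 / 2) / m ^ 2)
      (f' := fun t => (sinh (m * t) / m - t) / m ^ 2)
      (fun t => (((((hasDerivAt_cosh_mul m t).sub_const 1).div_const (m ^ 2)).sub
        ((hasDerivAt_pow 2 t).div_const 2)).div_const (m ^ 2)).congr_deriv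
          (by field_simp; ring)) (by simp) (x - s)).comp s
      ((hasDerivAt_id s).const_sub x)
    refine (((((((hasDerivAt_id s).const_sub L).pow 2).const_mul x).div_const
      (2 * m ^ 2 * L)).neg.add ((((hasDerivAt_cosh_mul m (L - s)).comp s
      ((hasDerivAt_id s).const_sub L)).const_mul (sinh (m * x))).div_const
        (m ^ 4 * sinh (m * L)))).sub hr).congr_deriv ?_
    rw [GreenK_sq_eq hm hL]
    simp only [id]
    field_simp
    ring
  rw [intervalIntegral.integral_eq_sub_of_hasDerivAt (fun s _ => hd s)
    (((continuous_GreenK_sq hm hL).comp (Continuous.prodMk_right x)).intervalIntegrable _ _)]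
  have hT := tanh_half_mul_sinh (m * L)
  rw [max_eq_right (sub_nonpos.2 hx.2), sub_zero, sub_zero, max_eq_left hx.1, greenMass, dirichletMass]
  simp only [mul_zero, cosh_zero, sub_self]
  generalize sinh (m * x) = a, sinh (m * L) = S, cosh (m * L) = C at *
  field_simp
  linear_combination (2 * L * a) * hT

theorem continuous_greenMass (m L : ℝ) : Continuous (greenMass m L) := by
  unfold greenMass dirichletMass
  fun_prop

theorem integral_greenMass (hm : 0 < m) (L : ℝ) :
    ∫ x in (0 : ℝ)..L, greenMass m L x =
      L ^ 3 / (12 * m ^ 2) - (L - 2 * tanh (m * L / 2) / m) / m ^ 4 := by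
  have hd : ∀ x, HasDerivAt (fun x => ((L * x ^ 2 / 2 - x ^ 3 / 3) / 2 -
      (tanh (m * L / 2) * cosh (m * x) / m - sinh (m * x) / m + x) / m ^ 2) / m ^ 2)
      (greenMass m L x) x := by
    intro x
    refine ((((((hasDerivAt_pow 2 x).const_mul L).div_const 2).sub
      ((hasDerivAt_pow 3 x).div_const 3)).div_const 2).sub
      ((((((hasDerivAt_cosh_mul m x).const_mul (tanh (m * L / 2))).div_const m).sub
      ((hasDerivAt_sinh_mul m x).div_const m)).add (hasDerivAt_id x)).div_const (m ^ 2))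
      |>.div_const (m ^ 2)).congr_deriv ?_
    rw [greenMass, dirichletMass]
    field_simp
    ring
  rw [intervalIntegral.integral_eq_sub_of_hasDerivAt (fun s _ => hd s)
    ((continuous_greenMass m L).intervalIntegrable _ _)]
  have hT := tanh_half_mul_cosh_add_one (m * L)
  simp only [mul_zero, cosh_zero, sinh_zero]
  generalize sinh (m * L) = S, cosh (m * L) = C, tanh (m * L / 2) = T at *
  field_simp
  linear_combination (-144 : ℝ) * hT

theorem dirichletMass_eq (m L x : ℝ) :
    dirichletMass m L x =
      2 * sinh (m * x / 2) * sinh (m * (L - x) / 2) / (m ^ 2 * cosh (m * L / 2)) := by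
  obtain ⟨a, ha⟩ : ∃ a, m * x = 2 * a := ⟨m * x / 2, by ring⟩
  have hc := (cosh_pos (m * L / 2)).ne'
  have h : m * (L - x) / 2 = m * L / 2 - a := by linear_combination (-1 / 2 : ℝ) * ha
  rw [dirichletMass, h, ha, mul_div_cancel_left₀ a two_ne_zero, sinh_sub, sinh_two_mul,
    cosh_two_mul, cosh_sq, tanh_eq_sinh_div_cosh]
  field_simp
  ring

theorem dirichletMass_symm (m L x : ℝ) : dirichletMass m L (L - x) = dirichletMass m L x := by
  rw [dirichletMass_eq, dirichletMass_eq, sub_sub_cancel]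
  ring

theorem greenMass_symm (m L x : ℝ) : greenMass m L (L - x) = greenMass m L x := by
  rw [greenMass, greenMass, dirichletMass_symm]
  ring

theorem dirichletMass_nonneg (hm : 0 < m) {x : ℝ} (hx : x ∈ Set.Icc 0 L) :
    0 ≤ dirichletMass m L x := by
  rw [dirichletMass_eq]
  have h₁ : 0 ≤ sinh (m * x / 2) := sinh_nonneg_iff.2 (by have := hx.1; positivity)
  have h₂ : 0 ≤ sinh (m * (L - x) / 2) :=
    sinh_nonneg_iff.2 (by have := sub_nonneg.2 hx.2; positivity)
  have := cosh_pos (m * L / 2)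
  positivity

theorem dirichletMass_le (m L x : ℝ) :
    dirichletMass m L x ≤ tanh (m * L / 2) * sinh (m * x) / m ^ 2 := by
  rw [dirichletMass]
  gcongr
  linarith [one_le_cosh (m * x)]

theorem greenMass_nonneg (hm : 0 < m) {x : ℝ} (hx : x ∈ Set.Icc 0 L) :
    0 ≤ greenMass m L x := by
  refine div_nonneg (sub_nonneg.2 ?_) (sq_nonneg m)
  have ha : 0 ≤ m * x / 2 := by have := hx.1; positivity
  have hb : 0 ≤ m * (L - x) / 2 := by have := sub_nonneg.2 hx.2; positivity
  have hc := cosh_pos (m * L / 2)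
  rw [dirichletMass_eq, div_le_iff₀ (by positivity)]
  have hadd : m * L / 2 = m * x / 2 + m * (L - x) / 2 := by ring
  have h : sinh (m * x / 2) * sinh (m * (L - x) / 2) ≤
      (m * x / 2) * (m * (L - x) / 2) * cosh (m * L / 2) := by
    calc sinh (m * x / 2) * sinh (m * (L - x) / 2)
        ≤ (m * x / 2 * cosh (m * x / 2)) * (m * (L - x) / 2 * cosh (m * (L - x) / 2)) :=
          mul_le_mul (sinh_le_self_mul_cosh ha) (sinh_le_self_mul_cosh hb)
            (sinh_nonneg_iff.2 hb) (mul_nonneg ha (cosh_pos _).le)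
      _ = (m * x / 2) * (m * (L - x) / 2) * (cosh (m * x / 2) * cosh (m * (L - x) / 2)) := by
          ring
      _ ≤ (m * x / 2) * (m * (L - x) / 2) * cosh (m * L / 2) := by
          gcongr
          rw [hadd, cosh_add]
          linarith [mul_nonneg (sinh_nonneg_iff.2 ha) (sinh_nonneg_iff.2 hb)]
  linarith

/-- The slope at the origin of `greenMass m L` is nonnegative. -/
theorem greenSlope_nonneg (hm : 0 < m) (hL : 0 < L) :
    0 ≤ L / (2 * m ^ 2) - tanh (m * L / 2) / m ^ 3 := by
  have h := tanh_le_self (a := m * L / 2) (by positivity)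
  have : L / (2 * m ^ 2) - tanh (m * L / 2) / m ^ 3 = (m * L / 2 - tanh (m * L / 2)) / m ^ 3 := by
    field_simp
  rw [this]
  exact div_nonneg (sub_nonneg.2 h) (by positivity)

theorem greenMass_le (hm : 0 < m) (hL : 0 < L) {x : ℝ} (hx : x ∈ Set.Icc 0 L) :
    greenMass m L x ≤ (L / (2 * m ^ 2) - tanh (m * L / 2) / m ^ 3) * (sinh (m * x) / m) := by
  have hx0 := hx.1
  have hmx : 0 ≤ m * x := by positivity
  have hlin : greenMass m L x ≤ (L / (2 * m ^ 2) - tanh (m * L / 2) / m ^ 3) * x := by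
    obtain ⟨a, ha⟩ : ∃ a, m * x = 2 * a := ⟨m * x / 2, by ring⟩
    have ha0 : 0 ≤ a := by linarith
    have hT : tanh a ≤ tanh (m * L / 2) := tanh_le_tanh (by nlinarith [hx.2])
    have hs : a ≤ sinh a := self_le_sinh_iff.2 ha0
    have hc := one_le_cosh a
    have hta : tanh a * cosh a = sinh a := by
      rw [tanh_eq_sinh_div_cosh, div_mul_cancel₀ _ (cosh_pos a).ne']
    have key : sinh a ^ 2 - a ^ 2 ≤ tanh (m * L / 2) * (sinh a * cosh a - a) := by
      have h₁ := mul_le_mul_of_nonneg_right hT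
        (show 0 ≤ sinh a * cosh a - a by nlinarith)
      have h₂ := mul_le_mul_of_nonneg_left (tanh_le_self ha0) ha0
      nlinarith
    have hxa : x = 2 * a / m := by field_simp; linarith
    have : (L / (2 * m ^ 2) - tanh (m * L / 2) / m ^ 3) * x - greenMass m L x =
        2 * (tanh (m * L / 2) * (sinh a * cosh a - a) - (sinh a ^ 2 - a ^ 2)) / m ^ 4 := by
      rw [greenMass, dirichletMass, ha, sinh_two_mul, cosh_two_mul, cosh_sq, hxa]
      field_simp
      ring
    have h0 : 0 ≤ 2 * (tanh (m * L / 2) * (sinh a * cosh a - a) - (sinh a ^ 2 - a ^ 2)) / m ^ 4 :=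
      div_nonneg (by linarith) (by positivity)
    linarith
  refine hlin.trans (mul_le_mul_of_nonneg_left ?_ (greenSlope_nonneg hm hL))
  rw [le_div_iff₀ hm, mul_comm]
  exact self_le_sinh_iff.2 hmx

theorem mul_le_of_le_sigmaFun {N : ℝ} (hm : 0 < m) (hL : 0 < L) (hN0 : 0 ≤ N)
    (hN : N ≤ 4 * m ^ 2 / L ^ 3 * sigmaFun (m * L)) :
    N * (6 * (m * L) * cosh (m * L) + 6 * (m * L) - 12 * sinh (m * L) - (m * L) ^ 3) ≤
      12 * m ^ 5 := by
  rw [sigmaFun] at hN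
  set D := 6 * (m * L) * cosh (m * L) + 6 * (m * L) - 12 * sinh (m * L) - (m * L) ^ 3
  rcases le_or_gt D 0 with hD | hD
  · exact (mul_nonpos_of_nonneg_of_nonpos hN0 hD).trans (by positivity)
  · rw [← le_div_iff₀ hD]
    refine hN.trans_eq ?_
    field_simp
    ring

theorem mul_dirichletMass_mul_greenMass_le {N : ℝ} (hm : 0 < m) (hL : 0 < L) (hN0 : 0 ≤ N)
    (hN : N ≤ 4 * m ^ 2 / L ^ 3 * sigmaFun (m * L)) {x t : ℝ} (hx : x ∈ Set.Icc 0 L)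
    (ht : t ∈ Set.Icc 0 L) :
    N * (dirichletMass m L x * greenMass m L t) ≤
      (1 + N * ∫ x in (0 : ℝ)..L, greenMass m L x) *
        (sinh (m * x) * sinh (m * t) / (m * sinh (m * L))) := by
  have hx0 := hx.1
  have ht0 := ht.1
  have hS : 0 < sinh (m * L) := sinh_pos_iff.2 (by positivity)
  have hα : 0 ≤ sinh (m * x) := sinh_nonneg_iff.2 (by positivity)
  have hβ : 0 ≤ sinh (m * t) := sinh_nonneg_iff.2 (by positivity)
  have hD := mul_le_of_le_sigmaFun hm hL hN0 hN
  have hT₁ := tanh_half_mul_sinh (m * L)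
  have hT₂ := tanh_half_mul_cosh_add_one (m * L)
  rw [integral_greenMass hm]
  have hprod := mul_le_mul (dirichletMass_le m L x) (greenMass_le hm hL ht)
    (greenMass_nonneg hm ht) ((dirichletMass_nonneg hm hx).trans (dirichletMass_le m L x))
  refine (mul_le_mul_of_nonneg_left hprod hN0).trans ?_
  set T := tanh (m * L / 2)
  have hcoef : N * (T * sinh (m * L) * (m * L / 2 - T)) ≤
      m ^ 5 + N * ((m * L) ^ 3 / 12 - m * L + 2 * T) := by
    have : T * sinh (m * L) * (m * L / 2 - T) - ((m * L) ^ 3 / 12 - m * L + 2 * T) =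
        (6 * (m * L) * cosh (m * L) + 6 * (m * L) - 12 * sinh (m * L) - (m * L) ^ 3) / 12 := by
      linear_combination (m * L / 2 - T) * hT₁ - hT₂
    linear_combination hD / 12 + N * this
  have hfac : (1 + N * (L ^ 3 / (12 * m ^ 2) - (L - 2 * T / m) / m ^ 4)) *
        (sinh (m * x) * sinh (m * t) / (m * sinh (m * L))) -
      N * (T * sinh (m * x) / m ^ 2 * ((L / (2 * m ^ 2) - T / m ^ 3) * (sinh (m * t) / m))) =
      (m ^ 5 + N * ((m * L) ^ 3 / 12 - m * L + 2 * T) -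
        N * (T * sinh (m * L) * (m * L / 2 - T))) *
        (sinh (m * x) * sinh (m * t) / (m ^ 6 * sinh (m * L))) := by
    field_simp
    ring
  rw [← sub_nonneg, hfac]
  exact mul_nonneg (sub_nonneg.2 hcoef) (by positivity)

theorem mul_dirichletMass_mul_greenMass_le_dirichletK {N : ℝ} (hm : 0 < m) (hL : 0 < L)
    (hN0 : 0 ≤ N) (hN : N ≤ 4 * m ^ 2 / L ^ 3 * sigmaFun (m * L)) {x s : ℝ}
    (hx : x ∈ Set.Icc 0 L) (hs : s ∈ Set.Icc 0 L) :
    N * (dirichletMass m L x * greenMass m L s) ≤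
      (1 + N * ∫ x in (0 : ℝ)..L, greenMass m L x) * dirichletK m L x s := by
  have hsymm : ∀ {t : ℝ}, t ∈ Set.Icc 0 L → L - t ∈ Set.Icc 0 L := fun ht =>
    ⟨sub_nonneg.2 ht.2, sub_le_self L ht.1⟩
  rcases le_total x s with h | h
  · rw [dirichletK_of_le h, ← greenMass_symm]
    exact mul_dirichletMass_mul_greenMass_le hm hL hN0 hN hx (hsymm hs)
  · rw [dirichletK_of_ge hm hL h, ← dirichletMass_symm]
    exact mul_dirichletMass_mul_greenMass_le hm hL hN0 hN (hsymm hx) hs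

theorem integral_integral_GreenK_sq_mul (hm : 0 < m) (hL : 0 < L) {p : ℝ → ℝ}
    (hp : Continuous p) :
    ∫ x in (0 : ℝ)..L, ∫ s in (0 : ℝ)..L, GreenK (m ^ 2) L x s * p s =
      ∫ s in (0 : ℝ)..L, greenMass m L s * p s := by
  have hc : Continuous fun q : ℝ × ℝ => GreenK (m ^ 2) L q.1 q.2 * p q.2 :=
    (continuous_GreenK_sq hm hL).mul (hp.comp continuous_snd)
  rw [MeasureTheory.intervalIntegral_intervalIntegral_swap]
  · refine intervalIntegral.integral_congr fun s hs => ?_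
    rw [Set.uIcc_of_le hL.le] at hs
    simp only [intervalIntegral.integral_mul_const, GreenK_comm (m ^ 2) L _ s,
      integral_GreenK_sq hm hL hs]
  · exact (hc.continuousOn.integrableOn_compact
      (isCompact_uIcc.prod isCompact_uIcc)).mono_set
        (Set.prod_mono Set.uIoc_subset_uIcc Set.uIoc_subset_uIcc)

theorem hasDerivAt_integral_GreenK_sq_mul (hm : 0 < m) (hL : 0 < L) {p : ℝ → ℝ}
    (hp : Continuous p) (x : ℝ) :
    HasDerivAt (fun x => ∫ s in (0 : ℝ)..L, GreenK (m ^ 2) L x s * p s)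
      (∫ s in (0 : ℝ)..L, greenKDeriv m L x s * p s) x :=
  hasDerivAt_intervalIntegral_of_continuous
    ((continuous_GreenK_sq hm hL).mul (hp.comp continuous_snd))
    ((continuous_greenKDeriv m L).mul (hp.comp continuous_snd))
    (fun x s => (hasDerivAt_GreenK_sq hm hL x s).mul_const (p s)) x

theorem hasDerivAt_integral_greenKDeriv_mul (hm : 0 < m) (hL : 0 < L) {p : ℝ → ℝ}
    (hp : Continuous p) (x : ℝ) :
    HasDerivAt (fun x => ∫ s in (0 : ℝ)..L, greenKDeriv m L x s * p s)
      (-∫ s in (0 : ℝ)..L, dirichletK m L x s * p s) x := by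
  rw [← intervalIntegral.integral_neg]
  simp only [← neg_mul]
  exact hasDerivAt_intervalIntegral_of_continuous
    ((continuous_greenKDeriv m L).mul (hp.comp continuous_snd))
    ((continuous_dirichletK m L).neg.mul (hp.comp continuous_snd))
    (fun x s => (hasDerivAt_greenKDeriv hm hL x s).mul_const (p s)) x

theorem integral_GreenK_mul_left (hL : 0 ≤ L) (M : ℝ) (p : ℝ → ℝ) :
    ∫ s in (0 : ℝ)..L, GreenK M L 0 s * p s = 0 := by
  rw [intervalIntegral.integral_congr (g := fun _ => 0), intervalIntegral.integral_zero]
  intro s hs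
  rw [Set.uIcc_of_le hL] at hs
  simp [GreenK, hs.1]

theorem integral_GreenK_mul_right (hL : 0 ≤ L) (M : ℝ) (p : ℝ → ℝ) :
    ∫ s in (0 : ℝ)..L, GreenK M L L s * p s = 0 := by
  rw [intervalIntegral.integral_congr (g := fun _ => 0), intervalIntegral.integral_zero]
  intro s hs
  rw [Set.uIcc_of_le hL] at hs
  simp only [GreenK_comm M L L s]
  simp [GreenK, hs.2]

end

theorem nonneg_and_iteratedDeriv_two_nonpos {L M N : ℝ} (hL : 0 < L) (hM : 0 < M)
    (hN0 : 0 ≤ N) (hN : N ≤ 4 * M / L ^ 3 * sigmaFun (Real.sqrt M * L))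
    {p : ℝ → ℝ} (hp : ContinuousOn p (Set.Icc 0 L)) (hp0 : ∀ x ∈ Set.Icc (0:ℝ) L, 0 ≤ p x)
    {y : ℝ → ℝ}
    (hy : ∀ x, y x = (∫ s in (0:ℝ)..L, GreenK M L x s * p s)
      - (N * ∫ s in (0:ℝ)..L, GreenK M L x s) /
          (1 + N * ∫ x in (0:ℝ)..L, ∫ s in (0:ℝ)..L, GreenK M L x s)
        * ∫ x in (0:ℝ)..L, ∫ s in (0:ℝ)..L, GreenK M L x s * p s)
    {x : ℝ} (hx : x ∈ Set.Icc (0:ℝ) L) : 0 ≤ y x ∧ iteratedDeriv 2 y x ≤ 0 := by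
  obtain ⟨m, hm, rfl⟩ : ∃ m > 0, M = m ^ 2 := ⟨√M, sqrt_pos.2 hM, (sq_sqrt hM.le).symm⟩
  rw [sqrt_sq hm.le] at hN
  obtain ⟨P, hP, hPp⟩ : ∃ P : ℝ → ℝ, Continuous P ∧ ∀ x ∈ Set.Icc 0 L, P x = p x :=
    ⟨Set.IccExtend hL.le ((Set.Icc 0 L).domRestrict p),
      (continuousOn_iff_continuous_domRestrict.1 hp).Icc_extend',
      fun x hx => Set.IccExtend_of_mem hL.le _ hx⟩
  have hpP : ∀ x, ∫ s in (0:ℝ)..L, GreenK (m ^ 2) L x s * p s =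
      ∫ s in (0:ℝ)..L, GreenK (m ^ 2) L x s * P s := fun x =>
    intervalIntegral.integral_congr fun s hs => by
      simp only [hPp s (Set.uIcc_of_le hL.le ▸ hs)]
  have hI : ∫ x in (0:ℝ)..L, ∫ s in (0:ℝ)..L, GreenK (m ^ 2) L x s =
      ∫ x in (0:ℝ)..L, greenMass m L x :=
    intervalIntegral.integral_congr fun x hx =>
      integral_GreenK_sq hm hL (Set.uIcc_of_le hL.le ▸ hx)
  simp only [hpP, integral_integral_GreenK_sq_mul hm hL hP, hI] at hy
  set I := ∫ x in (0:ℝ)..L, greenMass m L x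
  set J := ∫ s in (0:ℝ)..L, greenMass m L s * P s
  have hI0 : 0 ≤ I := intervalIntegral.integral_nonneg hL.le fun x hx => greenMass_nonneg hm hx
  have hden : 0 < 1 + N * I := by positivity
  have hyeq : y = fun x => (∫ s in (0:ℝ)..L, GreenK (m ^ 2) L x s * P s) -
      (∫ s in (0:ℝ)..L, GreenK (m ^ 2) L x s * 1) * (N / (1 + N * I) * J) := by
    funext x
    rw [hy x]
    simp only [mul_one]
    ring
  have hy' : ∀ x, HasDerivAt y ((∫ s in (0:ℝ)..L, greenKDeriv m L x s * P s) -
      (∫ s in (0:ℝ)..L, greenKDeriv m L x s * 1) * (N / (1 + N * I) * J)) x := fun x => by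
    rw [hyeq]
    exact (hasDerivAt_integral_GreenK_sq_mul hm hL hP x).sub
      ((hasDerivAt_integral_GreenK_sq_mul hm hL continuous_const x).mul_const _)
  have hy'' : ∀ x, HasDerivAt (deriv y) (-(∫ s in (0:ℝ)..L, dirichletK m L x s * P s) -
      -(∫ s in (0:ℝ)..L, dirichletK m L x s * 1) * (N / (1 + N * I) * J)) x := fun x => by
    rw [funext fun x => (hy' x).deriv]
    exact (hasDerivAt_integral_greenKDeriv_mul hm hL hP x).sub
      ((hasDerivAt_integral_greenKDeriv_mul hm hL continuous_const x).mul_const _)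
  have hneg : ∀ x ∈ Set.Icc 0 L, deriv^[2] y x ≤ 0 := by
    intro x hx
    have hK : Continuous fun s => dirichletK m L x s :=
      (continuous_dirichletK m L).comp (Continuous.prodMk_right x)
    have hle : (N * dirichletMass m L x) * J ≤
        (1 + N * I) * ∫ s in (0:ℝ)..L, dirichletK m L x s * P s := by
      rw [← intervalIntegral.integral_const_mul, ← intervalIntegral.integral_const_mul]
      refine intervalIntegral.integral_mono_on hL.le
        (((continuous_greenMass m L).mul hP).const_mul _ |>.intervalIntegrable _ _)
        ((hK.mul hP).const_mul _ |>.intervalIntegrable _ _) fun s hs => ?_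
      have := mul_le_mul_of_nonneg_right
        (mul_dirichletMass_mul_greenMass_le_dirichletK hm hL hN0 hN hx hs)
        ((hPp s hs).symm ▸ hp0 s hs)
      linarith
    rw [Function.iterate_succ_apply, Function.iterate_one, (hy'' x).deriv]
    simp only [mul_one, integral_dirichletK hm hL hx]
    rw [← div_le_iff₀' hden] at hle
    have : N * dirichletMass m L x * J / (1 + N * I) =
        dirichletMass m L x * (N / (1 + N * I) * J) := by ring
    linarith
  refine ⟨?_, by simpa only [iteratedDeriv_eq_iterate] using hneg x hx⟩
  have hconc : ConcaveOn ℝ (Set.Icc 0 L) y :=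
    concaveOn_of_deriv2_nonpos' (convex_Icc 0 L)
      (fun x _ => (hy' x).differentiableAt.differentiableWithinAt)
      (fun x _ => (hy'' x).differentiableAt.differentiableWithinAt) hneg
  have hy0 : y 0 = 0 := by
    simp only [hyeq, integral_GreenK_mul_left hL.le]
    simp
  have hyL : y L = 0 := by
    simp only [hyeq, integral_GreenK_mul_right hL.le]
    simp
  simpa [hy0, hyL] using hconc.min_le_of_mem_Icc (Set.left_mem_Icc.2 hL.le)
    (Set.right_mem_Icc.2 hL.le) hx

theorem stmt11 (L M N : ℝ) (hL : 0 < L) (hM : 0 < M)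
    (hN0 : 0 ≤ N) (hN : N ≤ 4 * M / L ^ 3 * sigmaFun (Real.sqrt M * L))
    (p : ℝ → ℝ) (hp : ContinuousOn p (Set.Icc 0 L))
    (y : ℝ → ℝ)
    (hy : ∀ x, y x = (∫ s in (0:ℝ)..L, GreenK M L x s * p s)
      - (N * ∫ s in (0:ℝ)..L, GreenK M L x s) /
          (1 + N * ∫ x in (0:ℝ)..L, ∫ s in (0:ℝ)..L, GreenK M L x s)
        * ∫ x in (0:ℝ)..L, ∫ s in (0:ℝ)..L, GreenK M L x s * p s) :
    ((∀ x ∈ Set.Icc (0:ℝ) L, 0 ≤ p x) →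
      ∀ x ∈ Set.Icc (0:ℝ) L, 0 ≤ y x ∧ iteratedDeriv 2 y x ≤ 0) ∧
    ((∀ x ∈ Set.Icc (0:ℝ) L, p x ≤ 0) →
      ∀ x ∈ Set.Icc (0:ℝ) L, y x ≤ 0 ∧ 0 ≤ iteratedDeriv 2 y x) := by
  refine ⟨fun h x hx => nonneg_and_iteratedDeriv_two_nonpos hL hM hN0 hN hp h hy hx,
    fun h x hx => ?_⟩
  have := nonneg_and_iteratedDeriv_two_nonpos (p := -p) (y := -y) hL hM hN0 hN hp.neg
    (fun x hx => neg_nonneg.2 (h x hx))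
    (fun x => by
      simp only [Pi.neg_apply, mul_neg, intervalIntegral.integral_neg, hy x]
      ring) hx
  rwa [iteratedDeriv_neg, Pi.neg_apply, neg_nonneg, neg_nonpos] at this
end
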